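/- For any weight-2 vector c ∈ F_2^16, the weight enumerator of the coset H_16 + c equals (1/15)(((x+y)^16 + (x−y)^16)/2 − W_{H_16}(x,y)) = 8(x^14 y^2 + x^2 y^14) + 112(x^12 y^4 + x^4 y^12) + 504(x^10 y^6 + x^6 y^10) + 800 x^8 y^8. -/

import Mathlib

open Finset
open scoped Classical

/-- Rows spanning the first-order Reed-Muller code RM(1,4) of length 16. -/
def r1 : Fin 16 → ZMod 2 := fun _ => 1
def r2 : Fin 16 → ZMod 2 := fun i => if i.val < 8 then 1 else 0
def r3 : Fin 16 → ZMod 2 := fun i => if i.val % 8 < 4 then 1 else 0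
def r4 : Fin 16 → ZMod 2 := fun i => if i.val % 4 < 2 then 1 else 0
def r5 : Fin 16 → ZMod 2 := fun i => if i.val % 2 = 0 then 1 else 0

/-- The first-order Reed-Muller code RM(1,4) ⊂ F₂¹⁶. -/
def RM : Submodule (ZMod 2) (Fin 16 → ZMod 2) :=
  Submodule.span (ZMod 2) {r1, r2, r3, r4, r5}

/-- The Hamming code H₁₆, the dual code of RM(1,4). -/
def H16 : Submodule (ZMod 2) (Fin 16 → ZMod 2) where
  carrier := {c | ∀ d ∈ RM, ∑ i, c i * d i = 0}
  zero_mem' := by intro d _; simp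
  add_mem' := by
    intro a b ha hb d hd
    have h1 := ha d hd
    have h2 := hb d hd
    have : ∑ i, (a + b) i * d i = (∑ i, a i * d i) + ∑ i, b i * d i := by
      simp [Pi.add_apply, add_mul, Finset.sum_add_distrib]
    simp only [Set.mem_setOf_eq] at *
    rw [this, h1, h2, add_zero]
  smul_mem' := by
    intro m a ha d hd
    have h1 := ha d hd
    have : ∑ i, (m • a) i * d i = m * ∑ i, a i * d i := by
      simp [Pi.smul_apply, smul_eq_mul, mul_assoc, Finset.mul_sum]
    simp only [Set.mem_setOf_eq] at *
    rw [this, h1, mul_zero]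


/-- The nontrivial additive character `a ↦ (-1) ^ a` of `ZMod 2`. -/
def signChar (R : Type*) [CommRing R] : AddChar (ZMod 2) R :=
  AddChar.zmodChar 2 (by norm_num : (-1 : R) ^ 2 = 1)

lemma signChar_eq_ite (R : Type*) [CommRing R] (a : ZMod 2) :
    signChar R a = if a = 0 then 1 else -1 := by
  rw [signChar, AddChar.zmodChar_apply]
  have h : ∀ a : ZMod 2, a.val = if a = 0 then 0 else 1 := by decide
  rw [h]
  split_ifs <;> simp

lemma signChar_sum {R κ : Type*} [CommRing R] (s : Finset κ) (f : κ → ZMod 2) :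
    signChar R (∑ j ∈ s, f j) = ∏ j ∈ s, signChar R (f j) := by
  induction s using Finset.cons_induction with
  | empty => simp
  | cons j s hj ih => rw [Finset.sum_cons, Finset.prod_cons, AddChar.map_add_eq_mul, ih]

lemma prod_ite_eq_zero_eq_pow_hammingNorm {R ι : Type*} [CommRing R] [Fintype ι] (x y : R)
    (v : ι → ZMod 2) :
    ∏ i, (if v i = 0 then x else y) =
      x ^ (Fintype.card ι - hammingNorm v) * y ^ hammingNorm v := by
  have h := Finset.card_filter_add_card_filter_not (s := (Finset.univ : Finset ι))
    (fun i => v i = 0)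
  rw [Finset.card_univ] at h
  have hn : hammingNorm v = (Finset.univ.filter fun i => ¬ v i = 0).card := by
    unfold hammingNorm
    congr
  rw [Finset.prod_ite, Finset.prod_const, Finset.prod_const, hn, ← h, Nat.add_sub_cancel]

/-- The transform of the weight monomial at the character attached to `d`. -/
lemma sum_signChar_mul_weight {R ι : Type*} [CommRing R] [Fintype ι] [DecidableEq ι] (x y : R)
    (d : ι → ZMod 2) :
    ∑ v : ι → ZMod 2, signChar R (d ⬝ᵥ v) *
        (x ^ (Fintype.card ι - hammingNorm v) * y ^ hammingNorm v) =
      (x + y) ^ (Fintype.card ι - hammingNorm d) * (x - y) ^ hammingNorm d := by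
  have h (i : ι) : (if d i = 0 then x + y else x - y) =
      ∑ a : ZMod 2, signChar R (d i * a) * (if a = 0 then x else y) := by
    have h2 (f : ZMod 2 → R) : ∑ a, f a = f 0 + f 1 := Fin.sum_univ_two f
    rw [h2]
    by_cases hd : d i = 0 <;> simp [signChar_eq_ite, hd, sub_eq_add_neg]
  rw [← prod_ite_eq_zero_eq_pow_hammingNorm, Finset.prod_congr rfl fun i _ => h i,
    Finset.prod_univ_sum, Fintype.piFinset_univ]
  refine Finset.sum_congr rfl fun v _ => ?_
  rw [Finset.prod_mul_distrib, prod_ite_eq_zero_eq_pow_hammingNorm, dotProduct, signChar_sum]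

/-- The product of the factors `1 + (-1) ^ (gⱼ ⬝ᵥ v)` detects orthogonality to all `gⱼ`. -/
lemma prod_one_add_signChar {R ι κ : Type*} [CommRing R] [Fintype ι] [Fintype κ]
    (g : κ → ι → ZMod 2) (v : ι → ZMod 2) :
    ∏ j, (1 + signChar R (g j ⬝ᵥ v)) =
      if ∀ j, g j ⬝ᵥ v = 0 then 2 ^ Fintype.card κ else 0 := by
  split_ifs with h
  · simp [h, one_add_one_eq_two]
  · push Not at h
    obtain ⟨j, hj⟩ := h
    exact Finset.prod_eq_zero (Finset.mem_univ j) (by simp [signChar_eq_ite, hj])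

lemma prod_one_add_signChar_eq_sum {R ι κ : Type*} [CommRing R] [Fintype ι] [Fintype κ]
    (g : κ → ι → ZMod 2) (v : ι → ZMod 2) :
    ∏ j, (1 + signChar R (g j ⬝ᵥ v)) =
      ∑ s : Finset κ, signChar R ((∑ j ∈ s, g j) ⬝ᵥ v) := by
  rw [Finset.prod_one_add, Finset.powerset_univ]
  simp_rw [sum_dotProduct, signChar_sum]

/-- The MacWilliams identity for a coset of the code with parity checks `g`. -/
lemma macWilliams_coset {R ι κ : Type*} [CommRing R] [Fintype ι] [DecidableEq ι] [Fintype κ]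
    (x y : R) (g : κ → ι → ZMod 2) (C : Submodule (ZMod 2) (ι → ZMod 2))
    (hC : ∀ v, v ∈ C ↔ ∀ j, g j ⬝ᵥ v = 0) (c : ι → ZMod 2) :
    2 ^ Fintype.card κ * ∑ v ∈ Finset.univ.filter (fun v : ι → ZMod 2 => v - c ∈ C),
        x ^ (Fintype.card ι - hammingNorm v) * y ^ hammingNorm v =
      ∑ s : Finset κ, signChar R ((∑ j ∈ s, g j) ⬝ᵥ c) *
        ((x + y) ^ (Fintype.card ι - hammingNorm (∑ j ∈ s, g j)) *
          (x - y) ^ hammingNorm (∑ j ∈ s, g j)) := by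
  have h (v : ι → ZMod 2) : (if v - c ∈ C then (2 : R) ^ Fintype.card κ else 0) =
      ∑ s : Finset κ, signChar R ((∑ j ∈ s, g j) ⬝ᵥ c) *
        signChar R ((∑ j ∈ s, g j) ⬝ᵥ v) := by
    simp only [hC]
    rw [← prod_one_add_signChar, prod_one_add_signChar_eq_sum]
    refine Finset.sum_congr rfl fun s _ => ?_
    rw [dotProduct_sub, CharTwo.sub_eq_add, AddChar.map_add_eq_mul, mul_comm]
  simp_rw [← sum_signChar_mul_weight, Finset.mul_sum, Finset.sum_filter]
  rw [Finset.sum_comm]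
  refine Finset.sum_congr rfl fun v _ => ?_
  simp_rw [← mul_assoc, ← Finset.sum_mul, ← h, ite_mul, zero_mul]

/-- The generators of `RM`, as a family. -/
def rmGen : Fin 5 → Fin 16 → ZMod 2 := ![r1, r2, r3, r4, r5]

lemma mem_H16_iff (v : Fin 16 → ZMod 2) : v ∈ H16 ↔ ∀ j, rmGen j ⬝ᵥ v = 0 := by
  have hr : ({r1, r2, r3, r4, r5} : Set (Fin 16 → ZMod 2)) = Set.range rmGen := by
    ext d
    simp only [rmGen, Matrix.range_cons, Matrix.range_empty, Set.mem_insert_iff,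
      Set.mem_union, Set.mem_singleton_iff, Set.mem_empty_iff_false, or_false]
  constructor
  · intro h j
    rw [dotProduct_comm]
    exact h _ (Submodule.subset_span (hr ▸ Set.mem_range_self j))
  · intro h d hd
    change v ⬝ᵥ d = 0
    rw [RM, hr] at hd
    induction hd using Submodule.span_induction with
    | mem d hd =>
      obtain ⟨j, rfl⟩ := hd
      rw [dotProduct_comm, h j]
    | zero => exact dotProduct_zero v
    | add a b _ _ ha hb => rw [dotProduct_add, ha, hb, add_zero]
    | smul m a _ ha => rw [dotProduct_smul, ha, smul_zero]

lemma hammingNorm_sum_rmGen (s : Finset (Fin 5)) (h₀ : s ≠ ∅) (h₁ : s ≠ {0}) :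
    hammingNorm (∑ j ∈ s, rmGen j) = 8 := by
  revert s
  decide +kernel

lemma hammingNorm_rmGen_zero : hammingNorm (rmGen 0) = 16 := by
  decide

/-- The weight enumerator of an even coset of `H16`, up to the factor `32`. -/
lemma weightEnumerator_coset_H16 {R : Type*} [CommRing R] (x y : R) (c : Fin 16 → ZMod 2)
    (hc : rmGen 0 ⬝ᵥ c = 0) :
    32 * ∑ v ∈ Finset.univ.filter (fun v : Fin 16 → ZMod 2 => v - c ∈ H16),
        x ^ (16 - hammingNorm v) * y ^ hammingNorm v =
      (x + y) ^ 16 + (x - y) ^ 16 +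
        ((if c ∈ H16 then 32 else 0) - 2) * ((x + y) ^ 8 * (x - y) ^ 8) := by
  have hm := macWilliams_coset x y rmGen H16 mem_H16_iff c
  have hp := (prod_one_add_signChar_eq_sum (R := R) rmGen c).symm.trans
    (prod_one_add_signChar rmGen c)
  have hmem : ({0} : Finset (Fin 5)) ∈ Finset.univ.erase ∅ := by simp
  simp only [← mem_H16_iff, Fintype.card_fin] at hm hp
  rw [← Finset.add_sum_erase _ _ (Finset.mem_univ ∅), ← Finset.add_sum_erase _ _ hmem] at hm hp
  have hs : ∀ s ∈ (Finset.univ.erase (∅ : Finset (Fin 5))).erase {0},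
      signChar R ((∑ j ∈ s, rmGen j) ⬝ᵥ c) *
        ((x + y) ^ (16 - hammingNorm (∑ j ∈ s, rmGen j)) *
          (x - y) ^ hammingNorm (∑ j ∈ s, rmGen j)) =
      signChar R ((∑ j ∈ s, rmGen j) ⬝ᵥ c) * ((x + y) ^ 8 * (x - y) ^ 8) := by
    intro s hs
    simp only [Finset.mem_erase] at hs
    rw [hammingNorm_sum_rmGen s hs.2.1 hs.1]
  rw [Finset.sum_congr rfl hs, ← Finset.sum_mul] at hm
  simp only [Finset.sum_empty, Finset.sum_singleton, zero_dotProduct, hc,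
    AddChar.map_zero_eq_one, hammingNorm_zero, hammingNorm_rmGen_zero] at hm hp
  have h32 : (2 : R) ^ 5 = 32 := by norm_num
  rw [h32] at hm hp
  linear_combination hm + (x + y) ^ 8 * (x - y) ^ 8 * hp

lemma exists_rmGen_ne {i j : Fin 16} (h : i ≠ j) : ∃ k, rmGen k i ≠ rmGen k j := by
  revert i j
  decide +kernel

lemma exists_eq_single_add_single {ι : Type*} [Fintype ι] [DecidableEq ι] {c : ι → ZMod 2}
    (hc : hammingNorm c = 2) :
    ∃ i j, i ≠ j ∧ c = Pi.single i 1 + Pi.single j 1 := by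
  obtain ⟨i, j, hij, h⟩ := Finset.card_eq_two.mp hc
  refine ⟨i, j, hij, funext fun k => ?_⟩
  have hk : c k ≠ 0 ↔ k = i ∨ k = j := by
    simpa using Finset.ext_iff.mp h k
  have h1 (a : ZMod 2) : a ≠ 0 → a = 1 := by decide +revert
  by_cases hi : k = i
  · subst hi
    simp [h1 _ (hk.mpr (Or.inl rfl)), hij]
  · by_cases hj : k = j
    · subst hj
      simp [h1 _ (hk.mpr (Or.inr rfl)), hi]
    · simp only [hi, hj, or_self, iff_false, not_not] at hk
      simp [hk, hi, hj]

lemma rmGen_zero_dotProduct_of_hammingNorm_eq_two {c : Fin 16 → ZMod 2}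
    (hc : hammingNorm c = 2) : rmGen 0 ⬝ᵥ c = 0 := by
  obtain ⟨i, j, -, rfl⟩ := exists_eq_single_add_single hc
  simp [dotProduct_add, rmGen, r1, CharTwo.add_self_eq_zero]

lemma notMem_H16_of_hammingNorm_eq_two {c : Fin 16 → ZMod 2} (hc : hammingNorm c = 2) :
    c ∉ H16 := by
  obtain ⟨i, j, hij, rfl⟩ := exists_eq_single_add_single hc
  obtain ⟨k, hk⟩ := exists_rmGen_ne hij
  rw [mem_H16_iff]
  intro h
  have hs := h k
  rw [dotProduct_add, dotProduct_single_one, dotProduct_single_one,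
    CharTwo.add_eq_zero] at hs
  exact hk hs

/-- Over an arbitrary ring the factor `32` cannot be cancelled, so pass through `ℤ[X, Y]`. -/
lemma weightEnumerator_eq_of_thirtyTwo_mul {R : Type*} [CommRing R] (x y : R)
    (S : Finset (Fin 16 → ZMod 2)) (p : MvPolynomial (Fin 2) ℤ)
    (h : 32 * ∑ v ∈ S, (MvPolynomial.X 0) ^ (16 - hammingNorm v) *
      (MvPolynomial.X 1) ^ hammingNorm v = 32 * p) :
    ∑ v ∈ S, x ^ (16 - hammingNorm v) * y ^ hammingNorm v =
      MvPolynomial.aeval ![x, y] p := by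
  rw [← mul_left_cancel₀ (by norm_num) h]
  simp [map_sum]

/-- The weight enumerator of a coset of H₁₆ with a weight-2
representative equals (1/15)(((x+y)¹⁶ + (x−y)¹⁶)/2 − W_{H₁₆}(x,y)), with the
stated expansion. -/
theorem h16_weight_two_coset_enumerator (R : Type*) [CommRing R] (x y : R)
    (c : Fin 16 → ZMod 2) (hc : hammingNorm c = 2) :
    (30 : R) * (∑ v ∈ Finset.univ.filter (fun v : Fin 16 → ZMod 2 => v - c ∈ H16),
        x ^ (16 - hammingNorm v) * y ^ (hammingNorm v))
      = (x + y) ^ 16 + (x - y) ^ 16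
        - 2 * ∑ w ∈ Finset.univ.filter (fun w : Fin 16 → ZMod 2 => w ∈ H16),
            x ^ (16 - hammingNorm w) * y ^ (hammingNorm w) ∧
    (∑ v ∈ Finset.univ.filter (fun v : Fin 16 → ZMod 2 => v - c ∈ H16),
        x ^ (16 - hammingNorm v) * y ^ (hammingNorm v))
      = 8 * (x ^ 14 * y ^ 2 + x ^ 2 * y ^ 14) + 112 * (x ^ 12 * y ^ 4 + x ^ 4 * y ^ 12)
        + 504 * (x ^ 10 * y ^ 6 + x ^ 6 * y ^ 10) + 800 * x ^ 8 * y ^ 8 := by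
  have he := rmGen_zero_dotProduct_of_hammingNorm_eq_two hc
  have hn := notMem_H16_of_hammingNorm_eq_two hc
  have hS : ∑ v ∈ Finset.univ.filter (fun v : Fin 16 → ZMod 2 => v - c ∈ H16),
      x ^ (16 - hammingNorm v) * y ^ (hammingNorm v) =
        8 * (x ^ 14 * y ^ 2 + x ^ 2 * y ^ 14) + 112 * (x ^ 12 * y ^ 4 + x ^ 4 * y ^ 12)
        + 504 * (x ^ 10 * y ^ 6 + x ^ 6 * y ^ 10) + 800 * x ^ 8 * y ^ 8 := by
    let X : MvPolynomial (Fin 2) ℤ := MvPolynomial.X 0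
    let Y : MvPolynomial (Fin 2) ℤ := MvPolynomial.X 1
    rw [weightEnumerator_eq_of_thirtyTwo_mul x y _
      (8 * (X ^ 14 * Y ^ 2 + X ^ 2 * Y ^ 14) + 112 * (X ^ 12 * Y ^ 4 + X ^ 4 * Y ^ 12)
        + 504 * (X ^ 10 * Y ^ 6 + X ^ 6 * Y ^ 10) + 800 * X ^ 8 * Y ^ 8)
      (by rw [weightEnumerator_coset_H16 _ _ c he, if_neg hn]; ring)]
    simp [X, Y]
  have hW : ∑ w ∈ Finset.univ.filter (fun w : Fin 16 → ZMod 2 => w ∈ H16),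
      x ^ (16 - hammingNorm w) * y ^ (hammingNorm w) =
        x ^ 16 + y ^ 16 + 140 * (x ^ 4 * y ^ 12 + x ^ 12 * y ^ 4)
        + 448 * (x ^ 6 * y ^ 10 + x ^ 10 * y ^ 6) + 870 * x ^ 8 * y ^ 8 := by
    let X : MvPolynomial (Fin 2) ℤ := MvPolynomial.X 0
    let Y : MvPolynomial (Fin 2) ℤ := MvPolynomial.X 1
    have h0 := weightEnumerator_coset_H16 X Y 0 (dotProduct_zero _)
    simp only [sub_zero, if_pos H16.zero_mem] at h0
    rw [weightEnumerator_eq_of_thirtyTwo_mul x y _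
      (X ^ 16 + Y ^ 16 + 140 * (X ^ 4 * Y ^ 12 + X ^ 12 * Y ^ 4)
        + 448 * (X ^ 6 * Y ^ 10 + X ^ 10 * Y ^ 6) + 870 * X ^ 8 * Y ^ 8)
      (h0.trans (by ring))]
    simp [X, Y]
  refine ⟨?_, hS⟩
  rw [hS, hW]
  ring
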